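/- arXiv:2010.09218 — 2 statements merged into one kernel-verified Lean document; each statement's English description precedes it below -/
import Mathlib

section
/- For every integer n ≥ 1 and every real φ₀ > 0, the improper integrals ∫_{φ₀}^{∞} φ^{n−1}/F_n(φ) dφ and ∫_{0}^{φ₀} φ^{n−1}/F_n(φ) dφ both diverge to +∞. (This is the key computation showing completeness of the soliton vector field ∇f of the Heisenberg Kähler–Ricci soliton.) -/
open MeasureTheory Filter Set

/-- `Fn n φ = (2·(−1)^(n+1)·(n+1)!/φ)·(∑_{k=0}^{n+1} (−1)^k φ^k/k! − e^{−φ})`. -/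
noncomputable def Fn (n : ℕ) (φ : ℝ) : ℝ :=
  2 * (-1 : ℝ) ^ (n + 1) * (Nat.factorial (n + 1)) / φ *
    ((∑ k ∈ Finset.range (n + 2), (-1 : ℝ) ^ k * φ ^ k / (Nat.factorial k)) - Real.exp (-φ))

/-- The remainder of the degree `m - 1` Taylor polynomial of `exp (-x)`, with its sign normalized. -/
noncomputable def expNegRemainder (m : ℕ) (x : ℝ) : ℝ :=
  (-1) ^ m * (Real.exp (-x) - ∑ k ∈ Finset.range m, (-1 : ℝ) ^ k * x ^ k / (Nat.factorial k))

theorem expNegRemainder_add_succ (m : ℕ) (x : ℝ) :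
    expNegRemainder m x + expNegRemainder (m + 1) x = x ^ m / (Nat.factorial m) := by
  have h : ((-1 : ℝ) ^ m) * (-1) ^ m = 1 := by rw [← mul_pow]; simp
  simp only [expNegRemainder, Finset.sum_range_succ, pow_succ]
  linear_combination x ^ m / (Nat.factorial m) * h

theorem expNegRemainder_succ_zero (m : ℕ) : expNegRemainder (m + 1) 0 = 0 := by
  simp [expNegRemainder, Finset.sum_range_succ']

theorem hasDerivAt_expNegRemainder_succ (m : ℕ) (x : ℝ) :
    HasDerivAt (expNegRemainder (m + 1)) (expNegRemainder m x) x := by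
  induction m with
  | zero =>
    have h : HasDerivAt (fun y : ℝ => 1 - Real.exp (-y)) (expNegRemainder 0 x) x := by
      simpa [expNegRemainder] using ((hasDerivAt_neg x).exp.const_sub 1)
    convert h using 1
    ext y
    simp [expNegRemainder]
  | succ m ih =>
    have hpow : HasDerivAt (fun y : ℝ => y ^ (m + 1) / (Nat.factorial (m + 1)))
        (x ^ m / (Nat.factorial m)) x := by
      refine ((hasDerivAt_pow (m + 1) x).div_const _).congr_deriv ?_
      rw [Nat.factorial_succ]
      push_cast
      field_simp
    have hfun : expNegRemainder (m + 1 + 1) =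
        (fun y : ℝ => y ^ (m + 1) / (Nat.factorial (m + 1))) - expNegRemainder (m + 1) := by
      ext y
      simp only [Pi.sub_apply]
      linarith [expNegRemainder_add_succ (m + 1) y]
    rw [hfun]
    exact (hpow.sub ih).congr_deriv (by linarith [expNegRemainder_add_succ m x])

theorem expNegRemainder_pos (m : ℕ) {x : ℝ} (hx : 0 < x) : 0 < expNegRemainder m x := by
  induction m generalizing x with
  | zero => simpa [expNegRemainder] using Real.exp_pos (-x)
  | succ m ih =>
    have hmono : StrictMonoOn (expNegRemainder (m + 1)) (Ici 0) := by
      refine strictMonoOn_of_deriv_pos (convex_Ici 0)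
        (fun y _ => (hasDerivAt_expNegRemainder_succ m y).continuousAt.continuousWithinAt) ?_
      intro y hy
      rw [interior_Ici] at hy
      rw [(hasDerivAt_expNegRemainder_succ m y).deriv]
      exact ih hy
    simpa [expNegRemainder_succ_zero] using hmono self_mem_Ici hx.le hx

theorem expNegRemainder_succ_le (m : ℕ) {x : ℝ} (hx : 0 < x) :
    expNegRemainder (m + 1) x ≤ x ^ m / (Nat.factorial m) := by
  linarith [expNegRemainder_add_succ m x, expNegRemainder_pos m hx]

theorem Fn_eq_expNegRemainder (n : ℕ) (φ : ℝ) :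
    Fn n φ = 2 * (Nat.factorial (n + 1)) / φ * expNegRemainder (n + 2) φ := by
  simp only [Fn, expNegRemainder]
  ring

theorem Fn_pos (n : ℕ) {φ : ℝ} (hφ : 0 < φ) : 0 < Fn n φ := by
  have := expNegRemainder_pos (n + 2) hφ
  rw [Fn_eq_expNegRemainder]
  positivity

theorem Fn_le (n : ℕ) {φ : ℝ} (hφ : 0 < φ) : Fn n φ ≤ 2 * φ ^ n := by
  rw [Fn_eq_expNegRemainder]
  calc 2 * (Nat.factorial (n + 1)) / φ * expNegRemainder (n + 2) φ
      ≤ 2 * (Nat.factorial (n + 1)) / φ * (φ ^ (n + 1) / (Nat.factorial (n + 1))) := by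
        gcongr
        exact expNegRemainder_succ_le (n + 1) hφ
    _ = 2 * φ ^ n := by
        field_simp
        ring

theorem inv_two_mul_le_pow_div_Fn {n : ℕ} (hn : 1 ≤ n) {φ : ℝ} (hφ : 0 < φ) :
    2⁻¹ * φ⁻¹ ≤ φ ^ (n - 1) / Fn n φ := by
  obtain ⟨m, rfl⟩ := Nat.exists_eq_add_of_le' hn
  rw [Nat.add_sub_cancel, le_div_iff₀ (Fn_pos _ hφ)]
  calc 2⁻¹ * φ⁻¹ * Fn (m + 1) φ ≤ 2⁻¹ * φ⁻¹ * (2 * φ ^ (m + 1)) := by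
        gcongr
        exact Fn_le (m + 1) hφ
    _ = φ ^ m := by
        field_simp
        ring

theorem lintegral_pow_div_Fn_eq_top {n : ℕ} (hn : 1 ≤ n) {s : Set ℝ} (hs : MeasurableSet s)
    (hpos : s ⊆ Ioi 0) (hinv : ¬ IntegrableOn (fun φ : ℝ => φ⁻¹) s) :
    (∫⁻ φ in s, ENNReal.ofReal (φ ^ (n - 1) / Fn n φ)) = ⊤ := by
  have htop : (∫⁻ φ in s, ENNReal.ofReal (2⁻¹ * φ⁻¹)) = ⊤ := by
    by_contra h
    have hint : IntegrableOn (fun φ : ℝ => 2⁻¹ * φ⁻¹) s := by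
      refine ⟨(measurable_inv.const_mul _).aestronglyMeasurable, ?_⟩
      rw [hasFiniteIntegral_iff_ofReal]
      · exact lt_top_iff_ne_top.mpr h
      · filter_upwards [ae_restrict_mem hs] with φ hφ
        have : 0 < φ := hpos hφ
        simp only [Pi.zero_apply]
        positivity
    refine hinv ((hint.const_mul 2).congr ?_)
    filter_upwards with φ
    ring
  rw [← top_le_iff, ← htop]
  exact setLIntegral_mono' hs fun φ hφ =>
    ENNReal.ofReal_le_ofReal (inv_two_mul_le_pow_div_Fn hn (hpos hφ))

/-- For every integer `n ≥ 1` and every `φ₀ > 0`, the integrals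
`∫_{φ₀}^{∞} φ^{n−1}/Fn n φ dφ` and `∫_{0}^{φ₀} φ^{n−1}/Fn n φ dφ` both diverge to `+∞`. -/
theorem flow_integrals_diverge (n : ℕ) (hn : 1 ≤ n) (φ₀ : ℝ) (hφ₀ : 0 < φ₀) :
    (∫⁻ φ in Set.Ioi φ₀, ENNReal.ofReal (φ ^ (n - 1) / Fn n φ)) = ⊤ ∧
    (∫⁻ φ in Set.Ioo (0 : ℝ) φ₀, ENNReal.ofReal (φ ^ (n - 1) / Fn n φ)) = ⊤ := by
  refine ⟨lintegral_pow_div_Fn_eq_top hn measurableSet_Ioi (Ioi_subset_Ioi hφ₀.le)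
      not_integrableOn_Ioi_inv,
    lintegral_pow_div_Fn_eq_top hn measurableSet_Ioo Ioo_subset_Ioi_self fun h => ?_⟩
  have h' : IntervalIntegrable (fun φ : ℝ => φ⁻¹) volume 0 φ₀ :=
    (intervalIntegrable_iff_integrableOn_Ioo_of_le hφ₀.le).mpr h
  rw [intervalIntegrable_inv_iff] at h'
  exact h'.elim hφ₀.ne fun h0 => h0 left_mem_uIcc
end

section
/- For all real numbers a, b with a² ≤ 1/2 and b² ≤ 1/2, and all φ > 0, the quantity Q(a,b,φ) = ((a+b)²/2)·S_kt(φ) + ((a−b)²/2)·S_xy(φ) + (1 + 2a² − 4b²)·S_kx(φ) satisfies −2/3 < Q(a,b,φ) < 0; moreover these bounds are sharp: the infimum of Q over all such (a,b,φ) equals −2/3 and the supremum equals 0. (This is the sharp sectional curvature bound −2/3 < Sec < 0 for the four-dimensional Heisenberg Kähler–Ricci soliton, where Q(a,b,φ) runs over all sectional curvatures of decomposable two-planes.) -/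
open MeasureTheory Filter Set

/-- `F₁(φ) = (4/φ)·(1 − φ + φ²/2 − e^{−φ})`. -/
noncomputable def F1 (φ : ℝ) : ℝ :=
  4 / φ * (1 - φ + φ ^ 2 / 2 - Real.exp (-φ))

/-- `S_kt(φ) = −(1 + φ + φ²/2)·F₁(φ)/φ² + φ`. -/
noncomputable def Skt (φ : ℝ) : ℝ :=
  -(1 + φ + φ ^ 2 / 2) * F1 φ / φ ^ 2 + φ

/-- `S_xy(φ) = −F₁(φ)/φ²`. -/
noncomputable def Sxy (φ : ℝ) : ℝ :=
  -F1 φ / φ ^ 2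

/-- `S_kx(φ) = ((2 + φ)·F₁(φ)/φ² − 2)/4`. -/
noncomputable def Skx (φ : ℝ) : ℝ :=
  ((2 + φ) * F1 φ / φ ^ 2 - 2) / 4

/-- The sectional curvature of the two-plane parametrized by `(a, b)`:
`Q(a,b,φ) = ((a+b)²/2)·S_kt(φ) + ((a−b)²/2)·S_xy(φ) + (1 + 2a² − 4b²)·S_kx(φ)`. -/
noncomputable def Q (a b φ : ℝ) : ℝ :=
  (a + b) ^ 2 / 2 * Skt φ + (a - b) ^ 2 / 2 * Sxy φ + (1 + 2 * a ^ 2 - 4 * b ^ 2) * Skx φ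

/-- A function vanishing at the origin whose derivative is positive on `(0, ∞)` is positive there. -/
lemma pos_of_hasDerivAt_pos {f f' : ℝ → ℝ} (hf : ∀ x, HasDerivAt f (f' x) x) (h0 : f 0 = 0)
    (hpos : ∀ x, 0 < x → 0 < f' x) {x : ℝ} (hx : 0 < x) : 0 < f x := by
  have hmono : StrictMonoOn f (Ici 0) := by
    refine strictMonoOn_of_deriv_pos (convex_Ici 0)
      (fun y _ => (hf y).continuousAt.continuousWithinAt) fun y hy => ?_
    rw [interior_Ici] at hy
    rw [(hf y).deriv]
    exact hpos y hy
  have := hmono self_mem_Ici hx.le hx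
  rwa [h0] at this

lemma hasDerivAt_exp_neg (x : ℝ) :
    HasDerivAt (fun y : ℝ => Real.exp (-y)) (-Real.exp (-x)) x := by
  simpa using (hasDerivAt_neg x).exp

lemma exp_neg_lt_quadratic {x : ℝ} (hx : 0 < x) : Real.exp (-x) < 1 - x + x ^ 2 / 2 := by
  have := pos_of_hasDerivAt_pos (f := fun y => 1 - y + y ^ 2 / 2 - Real.exp (-y))
    (f' := fun y => y - 1 + Real.exp (-y)) (fun y => by
      refine ((((hasDerivAt_id y).const_sub 1).add ((hasDerivAt_pow 2 y).div_const 2)).sub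
        (hasDerivAt_exp_neg y)).congr_deriv ?_
      norm_num; ring) (by simp)
    (fun y hy => by linarith [Real.add_one_lt_exp (neg_ne_zero.mpr hy.ne')]) hx
  linarith

lemma cubic_lt_exp_neg {x : ℝ} (hx : 0 < x) :
    1 - x + x ^ 2 / 2 - x ^ 3 / 6 < Real.exp (-x) := by
  have := pos_of_hasDerivAt_pos (f := fun y => Real.exp (-y) - (1 - y + y ^ 2 / 2 - y ^ 3 / 6))
    (f' := fun y => 1 - y + y ^ 2 / 2 - Real.exp (-y)) (fun y => by
      refine ((hasDerivAt_exp_neg y).sub ((((hasDerivAt_id y).const_sub 1).add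
        ((hasDerivAt_pow 2 y).div_const 2)).sub ((hasDerivAt_pow 3 y).div_const 6))).congr_deriv ?_
      norm_num; ring) (by simp)
    (fun y hy => by linarith [exp_neg_lt_quadratic hy]) hx
  linarith

lemma exp_neg_lt_quartic {x : ℝ} (hx : 0 < x) :
    Real.exp (-x) < 1 - x + x ^ 2 / 2 - x ^ 3 / 6 + x ^ 4 / 24 := by
  have := pos_of_hasDerivAt_pos
    (f := fun y => 1 - y + y ^ 2 / 2 - y ^ 3 / 6 + y ^ 4 / 24 - Real.exp (-y))
    (f' := fun y => Real.exp (-y) - (1 - y + y ^ 2 / 2 - y ^ 3 / 6)) (fun y => by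
      refine ((((((hasDerivAt_id y).const_sub 1).add ((hasDerivAt_pow 2 y).div_const 2)).sub
        ((hasDerivAt_pow 3 y).div_const 6)).add ((hasDerivAt_pow 4 y).div_const 24)).sub
        (hasDerivAt_exp_neg y)).congr_deriv ?_
      norm_num; ring) (by simp)
    (fun y hy => by linarith [cubic_lt_exp_neg hy]) hx
  linarith

lemma exp_neg_mul_exp (x : ℝ) : Real.exp (-x) * Real.exp x = 1 := by
  rw [← Real.exp_add]; simp

/-- The `[1/1]` Padé bound for the exponential. -/
lemma pade_one_one_pos {x : ℝ} (hx : 0 < x) : 0 < x - 2 + (x + 2) * Real.exp (-x) := by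
  refine pos_of_hasDerivAt_pos (f := fun y => y - 2 + (y + 2) * Real.exp (-y))
    (f' := fun y => 1 - (y + 1) * Real.exp (-y)) (fun y => ?_) (by simp) (fun y hy => ?_) hx
  · refine (((hasDerivAt_id y).sub_const 2).add
      (((hasDerivAt_id y).add_const 2).mul (hasDerivAt_exp_neg y))).congr_deriv ?_
    norm_num; ring
  · have := mul_lt_mul_of_pos_left (Real.add_one_lt_exp hy.ne') (Real.exp_pos (-y))
    linarith [exp_neg_mul_exp y]

/-- The `[2/2]` Padé bound for the exponential. -/
lemma pade_two_two_pos {x : ℝ} (hx : 0 < x) :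
    0 < x ^ 2 - 6 * x + 12 - (x ^ 2 + 6 * x + 12) * Real.exp (-x) := by
  refine pos_of_hasDerivAt_pos
    (f := fun y => y ^ 2 - 6 * y + 12 - (y ^ 2 + 6 * y + 12) * Real.exp (-y))
    (f' := fun y => 2 * y - 6 + (y ^ 2 + 4 * y + 6) * Real.exp (-y))
    (fun y => ?_) (by simp) (fun y hy => ?_) hx
  · refine ((((hasDerivAt_pow 2 y).sub ((hasDerivAt_id y).const_mul 6)).add_const 12).sub
      ((((hasDerivAt_pow 2 y).add ((hasDerivAt_id y).const_mul 6)).add_const 12).mul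
        (hasDerivAt_exp_neg y))).congr_deriv ?_
    norm_num; ring
  refine pos_of_hasDerivAt_pos (f := fun y => 2 * y - 6 + (y ^ 2 + 4 * y + 6) * Real.exp (-y))
    (f' := fun y => 2 - (y ^ 2 + 2 * y + 2) * Real.exp (-y)) (fun z => ?_) (by simp)
    (fun z hz => ?_) hy
  · refine ((((hasDerivAt_id z).const_mul 2).sub_const 6).add
      ((((hasDerivAt_pow 2 z).add ((hasDerivAt_id z).const_mul 4)).add_const 6).mul
        (hasDerivAt_exp_neg z))).congr_deriv ?_
    norm_num; ring
  · have hq : 1 + z + z ^ 2 / 2 < Real.exp z := by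
      have := Real.sum_le_exp_of_nonneg hz.le 4
      norm_num [Finset.sum_range_succ, Nat.factorial] at this
      linarith [pow_pos hz 3]
    have := mul_lt_mul_of_pos_left hq (Real.exp_pos (-z))
    linarith [exp_neg_mul_exp z]

lemma sq_add_two_lt_exp_add_exp_neg {x : ℝ} (hx : 0 < x) :
    x ^ 2 + 2 < Real.exp x + Real.exp (-x) := by
  have hs : x / 2 < Real.sinh (x / 2) := Real.self_lt_sinh_iff.mpr (by linarith)
  have hc := Real.cosh_two_mul (x / 2)
  rw [Real.cosh_sq, mul_div_cancel₀ x two_ne_zero, Real.cosh_eq] at hc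
  nlinarith

/-- `Q` in terms of `g = F₁/φ²` and `m = -S_kx`. -/
lemma Q_eq (a b : ℝ) {x : ℝ} (hx : 0 < x) :
    Q a b x = x * -Skx x * (a + b) ^ 2 - (a ^ 2 + b ^ 2) * -Sxy x
      - (1 + 2 * a ^ 2 - 4 * b ^ 2) * -Skx x := by
  unfold Q Skt Skx Sxy
  field_simp
  ring

lemma neg_Sxy_eq {x : ℝ} (hx : 0 < x) :
    -Sxy x = (4 - 4 * x + 2 * x ^ 2 - 4 * Real.exp (-x)) / x ^ 3 := by
  unfold Sxy F1
  field_simp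
  ring

lemma neg_Skx_eq {x : ℝ} (hx : 0 < x) :
    -Skx x = (x - 2 + (x + 2) * Real.exp (-x)) / x ^ 3 := by
  unfold Skx F1
  field_simp
  ring

lemma Skx_neg {x : ℝ} (hx : 0 < x) : Skx x < 0 := by
  rw [← neg_pos, neg_Skx_eq hx]
  exact div_pos (pade_one_one_pos hx) (pow_pos hx 3)

lemma add_four_mul_neg_Skx_lt {x : ℝ} (hx : 0 < x) : (x + 4) * -Skx x < -Sxy x := by
  rw [neg_Skx_eq hx, neg_Sxy_eq hx, ← mul_div_assoc]
  refine div_lt_div_of_pos_right ?_ (pow_pos hx 3)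
  linarith [pade_two_two_pos hx]

lemma neg_Sxy_lt_two_thirds {x : ℝ} (hx : 0 < x) : -Sxy x < 2 / 3 := by
  rw [neg_Sxy_eq hx, div_lt_iff₀ (pow_pos hx 3)]
  linarith [cubic_lt_exp_neg hx]

lemma two_thirds_sub_lt_neg_Sxy {x : ℝ} (hx : 0 < x) : 2 / 3 - x / 6 < -Sxy x := by
  rw [neg_Sxy_eq hx, lt_div_iff₀ (pow_pos hx 3)]
  linarith [exp_neg_lt_quartic hx]

lemma neg_Sxy_lt_two_div {x : ℝ} (hx : 0 < x) : -Sxy x < 2 / x := by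
  rw [neg_Sxy_eq hx, div_lt_div_iff₀ (pow_pos hx 3) hx]
  have := mul_pos hx (sub_pos.mpr (Real.add_one_lt_exp (neg_ne_zero.mpr hx.ne')))
  linarith

/-- The discriminant inequality behind the upper bound on the curvature. -/
lemma discriminant_pos {x : ℝ} (hx : 0 < x) :
    0 < (-Sxy x) ^ 2 - 2 * x * -Sxy x * -Skx x - 4 * (-Skx x) ^ 2 := by
  have heq : (-Sxy x) ^ 2 - 2 * x * -Sxy x * -Skx x - 4 * (-Skx x) ^ 2
      = 4 * x ^ 2 * (1 + Real.exp (-x) ^ 2 - (x ^ 2 + 2) * Real.exp (-x)) / (x ^ 3) ^ 2 := by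
    rw [neg_Sxy_eq hx, neg_Skx_eq hx]
    field_simp
    ring
  have := mul_lt_mul_of_pos_left (sq_add_two_lt_exp_add_exp_neg hx) (Real.exp_pos (-x))
  have : 0 < 1 + Real.exp (-x) ^ 2 - (x ^ 2 + 2) * Real.exp (-x) := by
    linarith [exp_neg_mul_exp x]
  rw [heq]
  positivity

lemma neg_two_thirds_lt_Q {a b x : ℝ} (ha : a ^ 2 ≤ 1 / 2) (hb : b ^ 2 ≤ 1 / 2) (hx : 0 < x) :
    -2 / 3 < Q a b x := by
  rw [Q_eq a b hx]
  have hm := neg_pos.mpr (Skx_neg hx)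
  have hu := add_four_mul_neg_Skx_lt hx
  have hg := neg_Sxy_lt_two_thirds hx
  generalize -Skx x = m at *
  generalize -Sxy x = g at *
  have hxm : 0 < x * m := mul_pos hx hm
  have h1 : 0 ≤ (g + 2 * m - x * m) * (1 / 2 - a ^ 2) :=
    mul_nonneg (by linarith) (by linarith)
  have h2 : 0 ≤ (g - 4 * m - x * m) * (1 / 2 - b ^ 2) :=
    mul_nonneg (by linarith) (by linarith)
  have h3 : 0 ≤ x * m * (1 + 2 * a * b) :=
    mul_nonneg hxm.le (by linarith [sq_nonneg (a + b)])
  linarith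

lemma Q_neg {a b x : ℝ} (hb : b ^ 2 ≤ 1 / 2) (hx : 0 < x) : Q a b x < 0 := by
  rw [Q_eq a b hx]
  have hm := neg_pos.mpr (Skx_neg hx)
  have hu := add_four_mul_neg_Skx_lt hx
  have hD := discriminant_pos hx
  generalize -Skx x = m at *
  generalize -Sxy x = g at *
  have hxm : 0 < x * m := mul_pos hx hm
  have hp : 0 < g - x * m + 2 * m := by linarith
  by_cases hb0 : b = 0
  · subst hb0
    nlinarith [mul_nonneg (show 0 ≤ g + 2 * m - x * m by linarith) (sq_nonneg a)]
  · have hb2 : 0 < b ^ 2 := by positivity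
    have h1 : 0 < (g - x * m + 2 * m) *
        ((g - x * m + 2 * m) * a ^ 2 + (g - x * m - 2 * m) * b ^ 2 - 2 * (x * m) * a * b) := by
      linarith [mul_pos hD hb2, sq_nonneg ((g - x * m + 2 * m) * a - x * m * b)]
    have h2 := pos_of_mul_pos_right h1 hp.le
    linarith [mul_nonneg hm.le (sub_nonneg.mpr hb)]

lemma exists_sq_eq_half_Q_eq_Sxy :
    ∃ a b : ℝ, a ^ 2 ≤ 1 / 2 ∧ b ^ 2 ≤ 1 / 2 ∧ ∀ x, 0 < x → Q a b x = Sxy x := by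
  have h : √(1 / 2 : ℝ) ^ 2 = 1 / 2 := Real.sq_sqrt (by norm_num)
  refine ⟨√(1 / 2), -√(1 / 2), h.le, by rw [neg_sq, h], fun x hx => ?_⟩
  rw [Q_eq _ _ hx, neg_sq, h]
  ring

/-- For all `a, b` with `a² ≤ 1/2`, `b² ≤ 1/2` and all `φ > 0`, `−2/3 < Q(a,b,φ) < 0`,
and these bounds are sharp: the infimum of `Q` over all such `(a,b,φ)` is `−2/3` and the
supremum is `0`.  (This is the sharp bound `−2/3 < Sec < 0` for the four-dimensional
Heisenberg Kähler–Ricci soliton.) -/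
theorem sec_sharp_bounds :
    (∀ a b φ : ℝ, a ^ 2 ≤ 1 / 2 → b ^ 2 ≤ 1 / 2 → 0 < φ →
      -2 / 3 < Q a b φ ∧ Q a b φ < 0) ∧
    sInf {y : ℝ | ∃ a b φ : ℝ, a ^ 2 ≤ 1 / 2 ∧ b ^ 2 ≤ 1 / 2 ∧ 0 < φ ∧ Q a b φ = y}
      = -2 / 3 ∧
    sSup {y : ℝ | ∃ a b φ : ℝ, a ^ 2 ≤ 1 / 2 ∧ b ^ 2 ≤ 1 / 2 ∧ 0 < φ ∧ Q a b φ = y}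
      = 0 := by
  obtain ⟨a, b, ha, hb, hQ⟩ := exists_sq_eq_half_Q_eq_Sxy
  refine ⟨fun a b x ha hb hx => ⟨neg_two_thirds_lt_Q ha hb hx, Q_neg hb hx⟩, ?_, ?_⟩
  · refine csInf_eq_of_forall_ge_of_forall_gt_exists_lt
      ⟨_, a, b, 1, ha, hb, one_pos, rfl⟩ ?_ fun w hw => ?_
    · rintro _ ⟨a, b, x, ha, hb, hx, rfl⟩
      exact (neg_two_thirds_lt_Q ha hb hx).le
    · have hx : 0 < w + 2 / 3 := by linarith
      refine ⟨_, ⟨a, b, w + 2 / 3, ha, hb, hx, rfl⟩, ?_⟩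
      rw [hQ _ hx]
      linarith [two_thirds_sub_lt_neg_Sxy hx]
  · refine csSup_eq_of_forall_le_of_forall_lt_exists_gt
      ⟨_, a, b, 1, ha, hb, one_pos, rfl⟩ ?_ fun w hw => ?_
    · rintro _ ⟨a, b, x, ha, hb, hx, rfl⟩
      exact (Q_neg hb hx).le
    · have hx : 0 < 2 / -w := div_pos two_pos (neg_pos.mpr hw)
      refine ⟨_, ⟨a, b, 2 / -w, ha, hb, hx, rfl⟩, ?_⟩
      rw [hQ _ hx]
      have := neg_Sxy_lt_two_div hx
      rw [div_div_cancel₀ two_ne_zero] at this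
      linarith
end
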